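/- Let ξ be a norm on ℝ^N and let F be a norm on ℝ² satisfying F(t,s) = F(−t,s) = F(t,−s) for all (t,s). Then φ(x,z) := F(ξ(x), z) defines a norm on ℝ^N × ℝ, and its dual norm satisfies φ⁰(x,z) = F⁰(ξ⁰(x), z) for all (x,z), where φ⁰(q) := sup{p·q : φ(p) ≤ 1}, F⁰(t,s) := sup{tt' + ss' : F(t',s') ≤ 1} and ξ⁰(x) := sup{x·x' : ξ(x') ≤ 1}. -/

import Mathlib

open Set RealInnerProductSpace

/-- A norm on `ℝ^N`: convex, positively 1-homogeneous, symmetric and positive away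
from the origin. -/
def IsNormE {N : ℕ} (ξ : EuclideanSpace ℝ (Fin N) → ℝ) : Prop :=
  ConvexOn ℝ Set.univ ξ ∧ (∀ c : ℝ, 0 < c → ∀ p, ξ (c • p) = c * ξ p) ∧
    (∀ p, ξ (-p) = ξ p) ∧ (∀ p, p ≠ 0 → 0 < ξ p)

/-- A norm on `ℝ²`. -/
def IsNorm2 (F : ℝ × ℝ → ℝ) : Prop :=
  ConvexOn ℝ Set.univ F ∧ (∀ c : ℝ, 0 < c → ∀ p, F (c • p) = c * F p) ∧
    (∀ p, F (-p) = F p) ∧ (∀ p : ℝ × ℝ, p ≠ 0 → 0 < F p)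

/-- A norm on `ℝ^N × ℝ`. -/
def IsNormP {N : ℕ} (φ : EuclideanSpace ℝ (Fin N) × ℝ → ℝ) : Prop :=
  ConvexOn ℝ Set.univ φ ∧ (∀ c : ℝ, 0 < c → ∀ p, φ (c • p) = c * φ p) ∧
    (∀ p, φ (-p) = φ p) ∧ (∀ p, p ≠ 0 → 0 < φ p)

/-- Dual norm `ξ⁰(x) = sup {x·x' : ξ(x') ≤ 1}` on `ℝ^N`. -/
noncomputable def dualNormE {N : ℕ} (ξ : EuclideanSpace ℝ (Fin N) → ℝ)
    (x : EuclideanSpace ℝ (Fin N)) : ℝ :=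
  sSup ((fun p => ⟪x, p⟫) '' {p | ξ p ≤ 1})

/-- Dual norm `F⁰(t,s) = sup {tt' + ss' : F(t',s') ≤ 1}` on `ℝ²`. -/
noncomputable def dualNorm2 (F : ℝ × ℝ → ℝ) (q : ℝ × ℝ) : ℝ :=
  sSup ((fun p : ℝ × ℝ => q.1 * p.1 + q.2 * p.2) '' {p | F p ≤ 1})

/-- Dual norm `φ⁰(q) = sup {p·q : φ(p) ≤ 1}` on `ℝ^N × ℝ`. -/
noncomputable def dualNormP {N : ℕ} (φ : EuclideanSpace ℝ (Fin N) × ℝ → ℝ)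
    (q : EuclideanSpace ℝ (Fin N) × ℝ) : ℝ :=
  sSup ((fun p : EuclideanSpace ℝ (Fin N) × ℝ => ⟪q.1, p.1⟫ + q.2 * p.2) '' {p | φ p ≤ 1})

lemma aux_bound {E : Type*} [NormedAddCommGroup E] [NormedSpace ℝ E] [FiniteDimensional ℝ E]
    (f : E → ℝ) (hc : ConvexOn ℝ Set.univ f) (hh : ∀ c : ℝ, 0 < c → ∀ p, f (c • p) = c * f p)
    (hp : ∀ p, p ≠ 0 → 0 < f p) : ∃ C : ℝ, ∀ p, f p ≤ 1 → ‖p‖ ≤ C := by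
  have hcont : Continuous f := by
    rw [← continuousOn_univ]
    exact hc.continuousOn isOpen_univ
  have hcpt : IsCompact (Metric.sphere (0 : E) 1) := isCompact_sphere 0 1
  rcases (Metric.sphere (0 : E) 1).eq_empty_or_nonempty with he | hne
  · refine ⟨0, fun p _ => ?_⟩
    by_contra hcon
    have h0 : 0 < ‖p‖ := not_le.mp hcon
    have : (‖p‖⁻¹ • p) ∈ Metric.sphere (0 : E) 1 := by
      simp [norm_smul, h0.ne']
    rw [he] at this
    exact this
  · obtain ⟨q, hq, hmin⟩ := hcpt.exists_isMinOn hne hcont.continuousOn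
    have hq0 : q ≠ 0 := by
      rintro rfl
      simp at hq
    have hfq := hp q hq0
    refine ⟨(f q)⁻¹, fun p hp1 => ?_⟩
    by_cases hp0 : p = 0
    · subst hp0; simpa using hfq.le
    have h0 : 0 < ‖p‖ := norm_pos_iff.mpr hp0
    have hm : (‖p‖⁻¹ • p) ∈ Metric.sphere (0 : E) 1 := by
      simp [norm_smul, h0.ne']
    have h1 : f q ≤ f (‖p‖⁻¹ • p) := hmin hm
    rw [hh _ (inv_pos.mpr h0)] at h1
    have h2 : f q ≤ ‖p‖⁻¹ := h1.trans (by
      have := mul_le_mul_of_nonneg_left hp1 (inv_pos.mpr h0).le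
      simpa using this)
    exact (le_inv_comm₀ hfq h0).mp h2

lemma aux_zero {E : Type*} [AddCommGroup E] [Module ℝ E]
    (f : E → ℝ) (hh : ∀ c : ℝ, 0 < c → ∀ p, f (c • p) = c * f p) : f 0 = 0 := by
  have := hh 2 (by norm_num) 0
  rw [smul_zero] at this
  linarith

theorem stmt14 (N : ℕ)
    (ξ : EuclideanSpace ℝ (Fin N) → ℝ) (hξ : IsNormE ξ)
    (F : ℝ × ℝ → ℝ) (hF : IsNorm2 F)
    (hFsym : ∀ t s : ℝ, F (-t, s) = F (t, s) ∧ F (t, -s) = F (t, s)) :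
    IsNormP (fun p : EuclideanSpace ℝ (Fin N) × ℝ => F (ξ p.1, p.2)) ∧
    ∀ (x : EuclideanSpace ℝ (Fin N)) (z : ℝ),
      dualNormP (fun p : EuclideanSpace ℝ (Fin N) × ℝ => F (ξ p.1, p.2)) (x, z) =
        dualNorm2 F (dualNormE ξ x, z) := by
  obtain ⟨hξc, hξh, hξs, hξp⟩ := hξ
  obtain ⟨hFc, hFh, hFs, hFp⟩ := hF
  have hξ0 := aux_zero ξ hξh
  have hF0 := aux_zero F hFh
  have hξn : ∀ p, 0 ≤ ξ p := fun p => by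
    by_cases h : p = 0
    · rw [h, hξ0]
    · exact (hξp p h).le
  have hmono : ∀ a b s : ℝ, 0 ≤ a → a ≤ b → F (a, s) ≤ F (b, s) := by
    intro a b s ha hab
    rcases eq_or_lt_of_le (ha.trans hab) with hb | hb
    · have : a = b := by linarith
      rw [this]
    have h := hFc.2 (mem_univ (b, s)) (mem_univ (-b, s))
      (show (0:ℝ) ≤ (1 + a / b) / 2 by positivity)
      (show (0:ℝ) ≤ (1 - a / b) / 2 by have := (div_le_one hb).mpr hab; linarith) (by ring)
    rw [(hFsym b s).1] at h
    have e : ((1 + a / b) / 2) • (b, s) + ((1 - a / b) / 2) • (-b, s) = (a, s) := by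
      ext
      · simp; field_simp; ring
      · simp; ring
    rw [e] at h
    simp only [smul_eq_mul] at h
    linarith
  obtain ⟨Cξ, hCξ⟩ := aux_bound ξ hξc hξh hξp
  obtain ⟨CF, hCF⟩ := aux_bound F hFc hFh hFp
  refine ⟨⟨⟨convex_univ, ?_⟩, ?_, ?_, ?_⟩, ?_⟩
  · intro p _ q _ a b ha hb hab
    have h1 := hξc.2 (mem_univ p.1) (mem_univ q.1) ha hb hab
    have h2 := hFc.2 (mem_univ (ξ p.1, p.2)) (mem_univ (ξ q.1, q.2)) ha hb hab
    exact (hmono _ _ _ (hξn _) h1).trans h2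
  · intro c hc p
    have := hFh c hc (ξ p.1, p.2)
    simp only [Prod.smul_fst, Prod.smul_snd, hξh c hc]
    exact this
  · intro p
    simp only [Prod.fst_neg, Prod.snd_neg, hξs, (hFsym _ _).2]
  · intro p hp
    apply hFp
    intro h
    apply hp
    have h1 : ξ p.1 = 0 := congrArg Prod.fst h
    have h2 : p.2 = 0 := congrArg Prod.snd h
    ext1
    · by_contra h3
      exact (hξp _ h3).ne' h1
    · exact h2
  · intro x z
    have bξ : BddAbove ((fun p => ⟪x, p⟫) '' {p | ξ p ≤ 1}) := by
      refine ⟨‖x‖ * Cξ, ?_⟩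
      rintro _ ⟨p, hp, rfl⟩
      exact (real_inner_le_norm x p).trans
        (mul_le_mul_of_nonneg_left (hCξ p hp) (norm_nonneg x))
    have leξ : ∀ p, ξ p ≤ 1 → ⟪x, p⟫ ≤ dualNormE ξ x := fun p hp =>
      le_csSup bξ ⟨p, hp, rfl⟩
    have d0 : 0 ≤ dualNormE ξ x := by
      have := leξ 0 (by rw [hξ0]; norm_num)
      simpa using this
    have leξ' : ∀ p, ⟪x, p⟫ ≤ dualNormE ξ x * ξ p := by
      intro p
      by_cases h : p = 0
      · subst h; simp [hξ0]
      have h1 := hξp p h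
      have h2 := leξ ((ξ p)⁻¹ • p) (by
        rw [hξh _ (inv_pos.mpr h1), inv_mul_cancel₀ h1.ne'])
      rw [inner_smul_right] at h2
      rw [inv_mul_le_iff₀ h1] at h2
      linarith
    have bF : BddAbove ((fun p : ℝ × ℝ => (dualNormE ξ x, z).1 * p.1 + (dualNormE ξ x, z).2 * p.2)
        '' {p | F p ≤ 1}) := by
      refine ⟨dualNormE ξ x * CF + |z| * CF, ?_⟩
      rintro _ ⟨p, hp, rfl⟩
      have h := hCF p hp
      have h1 : |p.1| ≤ CF := (norm_fst_le p).trans h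
      have h2 : |p.2| ≤ CF := (norm_snd_le p).trans h
      have h3 := mul_le_mul_of_nonneg_left ((le_abs_self _).trans h1) d0
      have h4 := mul_le_mul_of_nonneg_left h2 (abs_nonneg z)
      have h5 := le_abs_self (z * p.2)
      rw [abs_mul] at h5
      simp only
      linarith
    have ub : ∀ p : EuclideanSpace ℝ (Fin N) × ℝ, F (ξ p.1, p.2) ≤ 1 →
        ⟪x, p.1⟫ + z * p.2 ≤ dualNorm2 F (dualNormE ξ x, z) := by
      intro p hp
      have h1 : dualNormE ξ x * ξ p.1 + z * p.2 ≤ dualNorm2 F (dualNormE ξ x, z) :=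
        le_csSup bF ⟨(ξ p.1, p.2), hp, rfl⟩
      have := leξ' p.1
      linarith
    apply le_antisymm
    · apply csSup_le
      · refine ⟨_, ⟨0, ?_, rfl⟩⟩
        show F (ξ 0, 0) ≤ 1
        rw [hξ0]
        exact hF0.le.trans zero_le_one
      · rintro _ ⟨p, hp, rfl⟩
        exact ub p hp
    · apply csSup_le
      · exact ⟨_, ⟨0, hF0.le.trans zero_le_one, rfl⟩⟩
      · rintro _ ⟨⟨t, s⟩, hp, rfl⟩
        have hp' : F (|t|, s) ≤ 1 := by
          rcases abs_choice t with h | h <;> rw [h]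
          · exact hp
          · rw [(hFsym t s).1]; exact hp
        set D := dualNormP (fun p : EuclideanSpace ℝ (Fin N) × ℝ => F (ξ p.1, p.2)) (x, z) with hD
        have key : ∀ p, ξ p ≤ 1 → |t| * ⟪x, p⟫ + z * s ≤ D := by
          intro p hp1
          have hb : F (ξ (|t| • p), s) ≤ 1 := by
            refine (hmono _ |t| s (hξn _) ?_).trans hp'
            rcases eq_or_lt_of_le (abs_nonneg t) with h | h
            · rw [← h, zero_smul, hξ0]
            · rw [hξh _ h]; nlinarith
          have e : |t| * ⟪x, p⟫ = ⟪x, |t| • p⟫ := (real_inner_smul_right x p |t|).symm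
          rw [e]
          refine le_csSup ⟨dualNorm2 F (dualNormE ξ x, z), ?_⟩ ⟨(|t| • p, s), hb, rfl⟩
          rintro _ ⟨q, hq, rfl⟩
          exact ub q hq
        show dualNormE ξ x * t + z * s ≤ D
        have h6 : dualNormE ξ x * t ≤ dualNormE ξ x * |t| :=
          mul_le_mul_of_nonneg_left (le_abs_self t) d0
        rcases eq_or_lt_of_le (abs_nonneg t) with h | h
        · have := key 0 (by rw [hξ0]; norm_num)
          rw [← h] at h6 this
          linarith
        · have : dualNormE ξ x ≤ (D - z * s) / |t| := by
            apply csSup_le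
            · exact ⟨_, ⟨0, hξ0.le.trans zero_le_one, rfl⟩⟩
            · rintro _ ⟨p, hp1, rfl⟩
              rw [le_div_iff₀ h]
              have := key p hp1
              simp only
              linarith
          rw [le_div_iff₀ h] at this
          linarith
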